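/- Let A be an n×n real matrix, P an n×n real orthogonal matrix with P·A·Pᵀ = Aᵀ (A is P-symmetric), and let Z, N be n×n real matrices satisfying P·Z·P = N. Let A⁻ be the Moore–Penrose pseudo-inverse of A (satisfying the four Penrose conditions). Then rank(A⁻ − N·A⁻·Z) ≤ 2·rank(A − Z·A·N). In displacement notation: δ^∇_{N,Z}{A⁻} ≤ 2·δ^∇_{Z,N}{A}. -/

import Mathlib

open Matrix

theorem aux_rank_sum {m k l o : Type*} [Fintype m] [Fintype k] [Fintype l] [Fintype o]
    (E : Matrix m k ℝ) (T : Matrix k l ℝ) (F : Matrix l o ℝ) (h : E * T * F = 0) :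
    (E * T).rank + (T * F).rank ≤ T.rank := by
  classical
  unfold Matrix.rank
  have h0 := LinearMap.finrank_range_add_finrank_ker
    (E.mulVecLin.domRestrict (LinearMap.range T.mulVecLin))
  rw [← h0]
  apply add_le_add
  · apply le_of_eq
    rw [LinearMap.range_domRestrict, Matrix.mulVecLin_mul, LinearMap.range_comp]
  · have hsub : ∀ x, (T * F) *ᵥ x ∈ LinearMap.range T.mulVecLin := fun x =>
      ⟨F *ᵥ x, by simp⟩
    have : LinearMap.range (T * F).mulVecLin ≤
        (LinearMap.ker (E.mulVecLin.domRestrict (LinearMap.range T.mulVecLin))).map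
          (LinearMap.range T.mulVecLin).subtype := by
      rintro _ ⟨x, rfl⟩
      refine ⟨⟨(T * F) *ᵥ x, hsub x⟩, ?_, rfl⟩
      simp only [SetLike.mem_coe, LinearMap.mem_ker, LinearMap.domRestrict_apply,
        Matrix.mulVecLin_apply, Matrix.mulVec_mulVec, ← Matrix.mul_assoc, h, Matrix.zero_mulVec]
    refine (Submodule.finrank_mono this).trans ?_
    exact Submodule.finrank_map_le _ _

theorem aux_rank_sandwich {m k l o : Type*} [Fintype m] [Fintype k] [Fintype l] [Fintype o]
    (E : Matrix m k ℝ) (T : Matrix k l ℝ) (F : Matrix l o ℝ) :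
    (E * T * F).rank ≤ T.rank :=
  (rank_mul_le_left _ _).trans (rank_mul_le_right _ _)

theorem aux_rank_add {m k : Type*} [Fintype m] [Fintype k]
    (S T : Matrix m k ℝ) : (S + T).rank ≤ S.rank + T.rank := by
  unfold Matrix.rank
  rw [Matrix.mulVecLin_add]
  have : LinearMap.range (S.mulVecLin + T.mulVecLin) ≤
      LinearMap.range S.mulVecLin ⊔ LinearMap.range T.mulVecLin := by
    rintro _ ⟨x, rfl⟩
    exact Submodule.add_mem_sup ⟨x, rfl⟩ ⟨x, rfl⟩
  exact (Submodule.finrank_mono this).trans (Submodule.finrank_add_le_finrank_add_finrank _ _)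

/-- Rank of a block triangular-like matrix from below. -/
theorem aux_block {n : ℕ} (X v u A : Matrix (Fin n) (Fin n) ℝ) (G H : Matrix (Fin n) (Fin n) ℝ)
    (hv : v * H = v) (hA : A * H = 0) (hu : G * u = u) (hGA : G * A = 0) :
    u.rank + A.rank + v.rank ≤ (fromBlocks X v u A).rank := by
  have e1 := aux_rank_sum (fromCols (0 : Matrix (Fin n) (Fin n) ℝ) 1) (fromBlocks X v u A)
    (fromRows 0 H) (by
      simp [fromCols_mul_fromBlocks, fromCols_mul_fromRows, hA])
  have e2 := aux_rank_sum G (fromCols u A) (fromRows (0 : Matrix (Fin n) (Fin n) ℝ) 1) (by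
      simp [mul_fromCols, fromCols_mul_fromRows, hGA])
  have e3 := rank_mul_le_right (fromCols (1 : Matrix (Fin n) (Fin n) ℝ) 0)
    (fromRows v (0 : Matrix (Fin n) (Fin n) ℝ))
  have e4 := rank_mul_le_left (G * fromCols u A) (fromRows (1 : Matrix (Fin n) (Fin n) ℝ) 0)
  simp [fromCols_mul_fromBlocks, fromBlocks_mul_fromRows, mul_fromCols, fromCols_mul_fromRows,
    hA, hv, hu, hGA] at e1 e2 e3 e4
  omega

theorem aux_proj {n : ℕ} (A p q X Y : Matrix (Fin n) (Fin n) ℝ) (hp : pᵀ = p) (hq : qᵀ = q)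
    (hpX : p = A * X) (hqY : q = A * Y) (hpA : p * A = A) (hqA : q * A = A) : p = q := by
  have a : p * q = q := by nth_rw 1 [hqY]; rw [← Matrix.mul_assoc, hpA, ← hqY]
  have b : q * p = p := by nth_rw 1 [hpX]; rw [← Matrix.mul_assoc, hqA, ← hpX]
  calc p = (q * p)ᵀ := by rw [b, hp]
    _ = q := by rw [transpose_mul, hp, hq, a]

theorem pseudoinverse_nabla_displacement_P_symmetric (n : ℕ)
    (A P Z N B : Matrix (Fin n) (Fin n) ℝ)
    (hP : P * Pᵀ = 1) (hsym : P * A * Pᵀ = Aᵀ) (hZN : P * Z * P = N)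
    (h1 : A * B * A = A) (h2 : B * A * B = B)
    (h3 : (A * B)ᵀ = A * B) (h4 : (B * A)ᵀ = B * A) :
    (B - N * B * Z).rank ≤ 2 * (A - Z * A * N).rank := by
  have hP' : Pᵀ * P = 1 := mul_eq_one_comm.mp hP
  have hsym' : P * Aᵀ * Pᵀ = A := by
    have := congrArg transpose hsym
    simpa [Matrix.mul_assoc] using this
  have cP : ∀ X, P * (Pᵀ * X) = X := fun X => by rw [← Matrix.mul_assoc, hP, Matrix.one_mul]
  have cP' : ∀ X, Pᵀ * (P * X) = X := fun X => by rw [← Matrix.mul_assoc, hP', Matrix.one_mul]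
  have a1 : A * (B * A) = A := by rw [← Matrix.mul_assoc, h1]
  have a2 : B * (A * B) = B := by rw [← Matrix.mul_assoc, h2]
  have a3 : ∀ X, A * (B * (A * X)) = A * X := fun X => by
    rw [← Matrix.mul_assoc B, ← Matrix.mul_assoc A, a1]
  have a4 : ∀ X, B * (A * (B * X)) = B * X := fun X => by
    rw [← Matrix.mul_assoc A, ← Matrix.mul_assoc B, a2]
  have hqAt : B * A * Aᵀ = Aᵀ := by
    rw [← h4, ← transpose_mul, a1]
  -- the projections are exchanged by `P`
  have hpq : P * (A * B) * Pᵀ = B * A := by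
    apply aux_proj Aᵀ _ _ (P * B * Pᵀ) Bᵀ _ h4
    · rw [← hsym]; simp only [Matrix.mul_assoc, cP']
    · rw [← transpose_mul, h4]
    · rw [← hsym]; simp only [Matrix.mul_assoc, cP', a3]
    · exact hqAt
    · rw [transpose_mul, transpose_mul, h3, transpose_transpose, Matrix.mul_assoc P]
  have hqp : P * (B * A) * Pᵀ = A * B := by
    apply aux_proj A _ _ (P * Bᵀ * Pᵀ) B _ h3
    · nth_rw 2 [← hsym']; rw [← h4, transpose_mul]; simp only [Matrix.mul_assoc, cP']
    · rfl
    · nth_rw 2 [← hsym']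
      have : P * (B * A) * Pᵀ * (P * Aᵀ * Pᵀ) = P * (B * A * Aᵀ) * Pᵀ := by
        simp only [Matrix.mul_assoc, cP']
      rw [this, hqAt, hsym']
    · rw [h1]
    · rw [transpose_mul, transpose_mul, h4, transpose_transpose, Matrix.mul_assoc P]
  have hpq' : P * (A * B) = B * A * P := by
    rw [← hpq]; simp only [Matrix.mul_assoc, hP', Matrix.mul_one]
  have hqp' : P * (B * A) = A * B * P := by
    rw [← hqp]; simp only [Matrix.mul_assoc, hP', Matrix.mul_one]
  have hAB : A.rank = B.rank := by
    apply le_antisymm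
    · have := aux_rank_sandwich A B A; rwa [h1] at this
    · have := aux_rank_sandwich B A B; rwa [h2] at this
  set Y := A - Z * A * N with hY
  set u := (1 - A * B) * Z * (A * B) with hu
  set v := B * A * N * (1 - B * A) with hv
  set X := B - B * A * N * B * Z * A * B with hX
  -- upper bound
  have hT : fromBlocks X v u A =
      (fromBlocks 1 (-(B * A * N * B)) 0 1 * fromBlocks 1 0 (Z * A) 1) *
        fromBlocks B 0 0 Y * (fromBlocks 1 (A * N) 0 1 * fromBlocks 1 0 (-(B * Z * A * B)) 1) := by
    simp only [fromBlocks_multiply]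
    rw [hX, hv, hu, hY]
    congr 1 <;>
    · simp only [Matrix.mul_assoc, Matrix.mul_add, Matrix.add_mul, Matrix.mul_sub, Matrix.sub_mul,
        Matrix.mul_one, Matrix.one_mul, Matrix.mul_zero, Matrix.zero_mul, Matrix.mul_neg,
        Matrix.neg_mul, a1, a2, a3, a4]
      abel
  have hTr : (fromBlocks X v u A).rank ≤ A.rank + Y.rank := by
    rw [hT]
    refine (aux_rank_sandwich _ _ _).trans ?_
    have : fromBlocks B 0 0 Y =
        fromRows (1 : Matrix (Fin n) (Fin n) ℝ) 0 * B * fromCols (1 : Matrix (Fin n) (Fin n) ℝ) 0 +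
        fromRows (0 : Matrix (Fin n) (Fin n) ℝ) 1 * Y *
          fromCols (0 : Matrix (Fin n) (Fin n) ℝ) 1 := by
      rw [fromRows_mul _ _ B, fromRows_mul _ _ Y, fromRows_mul_fromCols, fromRows_mul_fromCols, fromBlocks_add]
      simp
    rw [this, hAB]
    exact (aux_rank_add _ _).trans
      (add_le_add (aux_rank_sandwich _ _ _) (aux_rank_sandwich _ _ _))
  have huv : u.rank + A.rank + v.rank ≤ (fromBlocks X v u A).rank := by
    apply aux_block X v u A (1 - A * B) (1 - B * A) <;>
    · simp only [hu, hv, Matrix.mul_assoc, Matrix.mul_sub, Matrix.sub_mul,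
        Matrix.mul_one, Matrix.one_mul, a1, a2, a3, a4]
      abel
  have hXr : X.rank + A.rank ≤ (fromBlocks X v u A).rank := by
    have e := aux_rank_sandwich (fromBlocks (1 : Matrix (Fin n) (Fin n) ℝ) 0 0 (A * B)) (fromBlocks X v u A)
      (fromBlocks (1 : Matrix (Fin n) (Fin n) ℝ) 0 0 (B * A))
    have e' : fromBlocks (1 : Matrix (Fin n) (Fin n) ℝ) 0 0 (A * B) * fromBlocks X v u A * fromBlocks (1 : Matrix (Fin n) (Fin n) ℝ) 0 0 (B * A)
        = fromBlocks X 0 0 A := by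
      simp only [fromBlocks_multiply]
      congr 1 <;>
      · simp only [hu, hv, Matrix.mul_assoc, Matrix.mul_add, Matrix.add_mul, Matrix.mul_sub,
          Matrix.sub_mul, Matrix.mul_one, Matrix.one_mul, Matrix.mul_zero, Matrix.zero_mul,
          a1, a2, a3, a4]
        abel
    rw [e'] at e
    have e1 := aux_rank_sum (fromCols (1 : Matrix (Fin n) (Fin n) ℝ) 0) (fromBlocks X 0 0 A)
      (fromRows (0 : Matrix (Fin n) (Fin n) ℝ) 1) (by
        simp [fromCols_mul_fromBlocks, fromCols_mul_fromRows])
    have e2 := rank_mul_le_left (fromCols X (0 : Matrix (Fin n) (Fin n) ℝ))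
      (fromRows (1 : Matrix (Fin n) (Fin n) ℝ) 0)
    have e3 := rank_mul_le_right (fromCols (0 : Matrix (Fin n) (Fin n) ℝ) 1)
      (fromRows (0 : Matrix (Fin n) (Fin n) ℝ) A)
    simp [fromCols_mul_fromBlocks, fromBlocks_mul_fromRows, fromCols_mul_fromRows] at e1 e2 e3
    omega
  -- decomposition of the displaced pseudo-inverse
  have c1 : (1 - B * A) * N * (B * A) = P * u * P := by
    have : (1 - B * A) * P = P * (1 - A * B) := by
      rw [Matrix.sub_mul, Matrix.mul_sub, hpq', Matrix.one_mul, Matrix.mul_one]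
    calc _ = ((1 - B * A) * P) * Z * (P * (B * A)) := by
          rw [← hZN]; simp only [Matrix.mul_assoc]
      _ = _ := by rw [this, hqp', hu]; simp only [Matrix.mul_assoc]
  have c2 : v = P * (A * B * Z * (1 - A * B)) * P := by
    have : P * (1 - B * A) = (1 - A * B) * P := by
      rw [Matrix.sub_mul, Matrix.mul_sub, hqp', Matrix.one_mul, Matrix.mul_one]
    calc _ = ((B * A) * P) * Z * (P * (1 - B * A)) := by
          rw [hv, ← hZN]; simp only [Matrix.mul_assoc]
      _ = _ := by rw [this, ← hpq']; simp only [Matrix.mul_assoc]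
  have c3 : A * B * Z * (1 - A * B) = Pᵀ * v * Pᵀ := by
    rw [c2]; simp only [Matrix.mul_assoc, cP', hP, Matrix.mul_one]
  have hdec : B - N * B * Z = X + ((-(B * A * N * B)) * (Pᵀ * v * Pᵀ) * 1
      + 1 * (P * u * P) * (-(B * Z))) := by
    rw [← c1, ← c3, hX]
    simp only [Matrix.mul_assoc, Matrix.mul_sub, Matrix.sub_mul, Matrix.mul_neg,
        Matrix.neg_mul, Matrix.mul_one, Matrix.one_mul, a1, a2, a3, a4]
    abel
  have f1 := aux_rank_add X ((-(B * A * N * B)) * (Pᵀ * v * Pᵀ) * 1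
      + 1 * (P * u * P) * (-(B * Z)))
  have f2 := aux_rank_add ((-(B * A * N * B)) * (Pᵀ * v * Pᵀ) * 1) (1 * (P * u * P) * (-(B * Z)))
  have f3 := (aux_rank_sandwich (-(B * A * N * B)) (Pᵀ * v * Pᵀ) (1 : Matrix (Fin n) (Fin n) ℝ)).trans
    (aux_rank_sandwich Pᵀ v Pᵀ)
  have f4 := (aux_rank_sandwich (1 : Matrix (Fin n) (Fin n) ℝ) (P * u * P) (-(B * Z))).trans (aux_rank_sandwich P u P)
  rw [hdec]
  omega
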